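/- Let μ be a positive measure on the interval [0,1], let p ∈ (1,∞), and let q ∈ [1,∞) satisfy either (1 ≤ q < 2 and q < p) or (2 < q and q ≠ p). Then there is no linear map T : ℝ² → L_p([0,1], ℝ, dμ) such that ‖T(a)‖_{L_p(μ)} = (|a₁|^q + |a₂|^q)^{1/q} for all a = (a₁, a₂) ∈ ℝ²; that is, ℓ_q²(ℝ) does not embed isometrically into L_p([0,1], ℝ, dμ). -/

import Mathlib

open MeasureTheory


lemma rpow_add_mul_rpow_sub_one_mul_sub_le {r a b : ℝ} (hr : 1 ≤ r) (ha : 0 < a) (hb : 0 ≤ b) :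
    a ^ r + r * a ^ (r - 1) * (b - a) ≤ b ^ r := by
  have hs : -1 ≤ b / a - 1 := by
    have : 0 ≤ b / a := by positivity
    linarith
  have h := one_add_mul_self_le_rpow_one_add hs hr
  rw [add_sub_cancel, Real.div_rpow hb ha.le, le_div_iff₀ (Real.rpow_pos_of_pos ha r)] at h
  have h1 : a ^ r = a ^ (r - 1) * a := by
    rw [← Real.rpow_add_one ha.ne', sub_add_cancel]
  calc a ^ r + r * a ^ (r - 1) * (b - a) = (1 + r * (b / a - 1)) * a ^ r := by
        rw [h1]; field_simp
    _ ≤ b ^ r := h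

lemma abs_rpow_sub_abs_rpow_le {p : ℝ} (hp : 1 < p) (a b : ℝ) :
    |a| ^ p - |b| ^ p ≤ p * (|a| ^ (p - 2) * a * (a - b)) := by
  rcases eq_or_ne a 0 with rfl | ha
  · have : 0 ≤ |b| ^ p := by positivity
    simpa [Real.zero_rpow (by linarith : p ≠ 0)] using this
  have ha' : 0 < |a| := abs_pos.mpr ha
  have h := rpow_add_mul_rpow_sub_one_mul_sub_le hp.le ha' (abs_nonneg b)
  have h1 : |a| ^ (p - 1) = |a| ^ (p - 2) * |a| := by
    rw [← Real.rpow_add_one ha'.ne']; congr 1; ring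
  have hw : 0 ≤ |a| ^ (p - 2) := by positivity
  have h2 : 0 ≤ p * |a| ^ (p - 2) * (|a| * |b| - a * b) := by
    have : a * b ≤ |a| * |b| := by rw [← abs_mul]; exact le_abs_self _
    have : 0 ≤ |a| * |b| - a * b := by linarith
    positivity
  rw [h1] at h
  have h3 : p * |a| ^ (p - 2) * (|a| * |a|) = p * |a| ^ (p - 2) * (a * a) := by
    rw [abs_mul_abs_self]
  linarith

lemma abs_rpow_mul_sub_abs_rpow_mul_le {p M a b : ℝ} (hp : 2 < p) (ha : |a| ≤ M) (hb : |b| ≤ M)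
    (hab : b ≤ a) :
    |a| ^ (p - 2) * a - |b| ^ (p - 2) * b ≤ (p - 1) * M ^ (p - 2) * (a - b) := by
  have key : ∀ a b : ℝ, |a| ≤ M → 0 ≤ b → b ≤ a →
      |a| ^ (p - 2) * a - |b| ^ (p - 2) * b ≤ (p - 1) * M ^ (p - 2) * (a - b) := by
    intro a b ha hb hab
    rcases hab.eq_or_lt with rfl | hlt
    · simp
    have ha0 : 0 < a := hb.trans_lt hlt
    have h1 : ∀ c : ℝ, 0 ≤ c → |c| ^ (p - 2) * c = c ^ (p - 1) := by
      intro c hc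
      rcases hc.eq_or_lt with rfl | hc
      · rw [Real.zero_rpow (by linarith)]; simp
      · rw [abs_of_pos hc, ← Real.rpow_add_one hc.ne']; congr 1; ring
    rw [h1 a ha0.le, h1 b hb]
    have h := rpow_add_mul_rpow_sub_one_mul_sub_le (by linarith : 1 ≤ p - 1) ha0 hb
    rw [show p - 1 - 1 = p - 2 by ring] at h
    have h2 : a ^ (p - 2) ≤ M ^ (p - 2) :=
      Real.rpow_le_rpow ha0.le ((le_abs_self a).trans ha) (by linarith)
    have h3 : (p - 1) * a ^ (p - 2) * (a - b) ≤ (p - 1) * M ^ (p - 2) * (a - b) :=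
      mul_le_mul_of_nonneg_right (mul_le_mul_of_nonneg_left h2 (by linarith)) (by linarith)
    linarith
  rcases le_total 0 b with hb0 | hb0
  · exact key a b ha hb0 hab
  rcases le_total a 0 with ha0 | ha0
  · have h := key (-b) (-a) (by rwa [abs_neg]) (by linarith) (by linarith)
    rw [abs_neg, abs_neg] at h
    linarith
  · have h1 : |a| ^ (p - 2) ≤ M ^ (p - 2) := Real.rpow_le_rpow (abs_nonneg _) ha (by linarith)
    have h2 : |b| ^ (p - 2) ≤ M ^ (p - 2) := Real.rpow_le_rpow (abs_nonneg _) hb (by linarith)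
    have h0 : 0 ≤ M ^ (p - 2) := (by positivity : 0 ≤ |a| ^ (p - 2)).trans h1
    have h3 := mul_le_mul_of_nonneg_right h1 ha0
    have h4 := mul_le_mul_of_nonneg_right h2 (neg_nonneg.mpr hb0)
    have h5 : 0 ≤ (p - 2) * (M ^ (p - 2) * (a - b)) := by
      have : 0 ≤ a - b := by linarith
      have : 0 ≤ p - 2 := by linarith
      positivity
    linarith

/-- The second difference of `|·| ^ p` is at most quadratic in the step when `2 < p`. -/
lemma exists_second_difference_abs_rpow_le {p : ℝ} (hp : 2 < p) :
    ∃ C : ℝ, ∀ x y t : ℝ, 0 ≤ t → t ≤ 1 →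
      |x + t * y| ^ p + |x - t * y| ^ p - 2 * |x| ^ p ≤ C * t ^ 2 * (|x| ^ p + |y| ^ p) := by
  refine ⟨p * (p - 1) * 2 * 2 ^ p, ?_⟩
  have key : ∀ x y t : ℝ, 0 ≤ t → t ≤ 1 → 0 ≤ y →
      |x + t * y| ^ p + |x - t * y| ^ p - 2 * |x| ^ p
        ≤ p * (p - 1) * 2 * 2 ^ p * t ^ 2 * (|x| ^ p + |y| ^ p) := by
    intro x y t ht ht1 hy
    set M := |x| + |y| with hM
    have hM0 : 0 ≤ M := by positivity
    have hty : |t * y| ≤ |y| := by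
      rw [abs_mul, abs_of_nonneg ht]; exact mul_le_of_le_one_left (abs_nonneg _) ht1
    have h1 := abs_rpow_sub_abs_rpow_le (by linarith : 1 < p) (x + t * y) x
    have h2 := abs_rpow_sub_abs_rpow_le (by linarith : 1 < p) (x - t * y) x
    have hu : 0 ≤ t * y := by positivity
    have h3 := abs_rpow_mul_sub_abs_rpow_mul_le hp
      (show |x + t * y| ≤ M from (abs_add_le _ _).trans (by linarith))
      (show |x - t * y| ≤ M from (abs_sub _ _).trans (by linarith)) (by linarith)
    have h4 : |x + t * y| ^ p + |x - t * y| ^ p - 2 * |x| ^ p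
        ≤ p * (t * y) * ((p - 1) * M ^ (p - 2) * (2 * (t * y))) := by
      have := mul_le_mul_of_nonneg_left h3 (by positivity : 0 ≤ p * (t * y))
      nlinarith
    have h5 : M ^ (p - 2) * y ^ 2 ≤ M ^ p := by
      have h6 : y ^ 2 ≤ M ^ 2 := by
        rw [← sq_abs y]
        exact pow_le_pow_left₀ (abs_nonneg _) (by linarith [abs_nonneg x]) 2
      calc M ^ (p - 2) * y ^ 2 ≤ M ^ (p - 2) * M ^ 2 := by gcongr
        _ = M ^ p := by
          rw [← Real.rpow_natCast M 2, ← Real.rpow_add_of_nonneg hM0 (by linarith) (by norm_num)]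
          congr 1; push_cast; ring
    have h7 : M ^ p ≤ 2 ^ p * (|x| ^ p + |y| ^ p) := by
      have hx : 0 ≤ |x| ^ p := by positivity
      have hy : 0 ≤ |y| ^ p := by positivity
      rcases le_total |x| |y| with hxy | hxy
      · calc M ^ p ≤ (2 * |y|) ^ p := Real.rpow_le_rpow hM0 (by linarith) (by linarith)
          _ = 2 ^ p * |y| ^ p := Real.mul_rpow (by norm_num) (abs_nonneg _)
          _ ≤ _ := by gcongr; linarith
      · calc M ^ p ≤ (2 * |x|) ^ p := Real.rpow_le_rpow hM0 (by linarith) (by linarith)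
          _ = 2 ^ p * |x| ^ p := Real.mul_rpow (by norm_num) (abs_nonneg _)
          _ ≤ _ := by gcongr; linarith
    have hp1 : 0 ≤ p - 1 := by linarith
    calc _ ≤ p * (t * y) * ((p - 1) * M ^ (p - 2) * (2 * (t * y))) := h4
      _ = p * (p - 1) * 2 * t ^ 2 * (M ^ (p - 2) * y ^ 2) := by ring
      _ ≤ p * (p - 1) * 2 * t ^ 2 * (2 ^ p * (|x| ^ p + |y| ^ p)) :=
        mul_le_mul_of_nonneg_left (h5.trans h7) (by positivity)
      _ = _ := by ring
  intro x y t ht ht1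
  rcases le_total 0 y with hy | hy
  · exact key x y t ht ht1 hy
  · have h := key x (-y) t ht ht1 (by linarith)
    rw [abs_neg, mul_neg, sub_neg_eq_add, ← sub_eq_add_neg] at h
    linarith

/-- Clarkson's inequality for exponents at most two, pointwise form. -/
lemma abs_add_rpow_add_abs_sub_rpow_le {p : ℝ} (hp : 1 < p) (hp2 : p ≤ 2) (x y : ℝ) :
    |x + y| ^ p + |x - y| ^ p ≤ 2 * (|x| ^ p + |y| ^ p) := by
  have h0 : ∀ z : ℝ, |z| ^ p = (z ^ 2) ^ (p / 2) := by
    intro z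
    rw [← sq_abs, ← Real.rpow_natCast, ← Real.rpow_mul (abs_nonneg _)]
    congr 1; push_cast; ring
  simp only [h0]
  have h1 := (Real.concaveOn_rpow (by linarith : 0 ≤ p / 2) (by linarith : p / 2 ≤ 1)).2
    (sq_nonneg (x + y)) (sq_nonneg (x - y)) (by norm_num : (0 : ℝ) ≤ 1 / 2)
    (by norm_num : (0 : ℝ) ≤ 1 / 2) (by norm_num)
  have h2 := Real.rpow_add_le_add_rpow (sq_nonneg x) (sq_nonneg y) (by linarith : 0 ≤ p / 2)
    (by linarith : p / 2 ≤ 1)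
  simp only [smul_eq_mul] at h1
  rw [show 1 / 2 * (x + y) ^ 2 + 1 / 2 * (x - y) ^ 2 = x ^ 2 + y ^ 2 by ring] at h1
  linarith

lemma two_mul_abs_rpow_le {p : ℝ} (hp : 1 < p) (x y : ℝ) :
    2 * |x| ^ p ≤ |x + y| ^ p + |x - y| ^ p := by
  have h1 := abs_rpow_sub_abs_rpow_le hp x (x + y)
  have h2 := abs_rpow_sub_abs_rpow_le hp x (x - y)
  linarith

/-- The second difference of `|·| ^ p` is at least quadratic in a small relative step. -/
lemma exists_le_second_difference_abs_rpow {p : ℝ} (hp : 1 < p) :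
    ∃ c : ℝ, 0 < c ∧ ∀ x u : ℝ, |u| ≤ |x| / 2 →
      c * (|x| ^ p * (u / x) ^ 2) ≤ |x + u| ^ p + |x - u| ^ p - 2 * |x| ^ p := by
  set c : ℝ := p * (p - 1) / 2 * ((1 / 2) ^ p * (4 / 9)) with hc
  have hp1 : 0 < p - 1 := by linarith
  have hc0 : 0 < c := by positivity
  have hconv : ConvexOn ℝ (Set.Icc (1 / 2 : ℝ) (3 / 2)) (fun s => s ^ p - c * s ^ 2) := by
    refine convexOn_of_hasDerivWithinAt2_nonneg (convex_Icc _ _)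
      (f' := fun s => p * s ^ (p - 1) - c * (2 * s))
      (f'' := fun s => p * ((p - 1) * s ^ (p - 1 - 1)) - c * 2) ?_ ?_ ?_ ?_
    · refine ContinuousOn.sub (fun s hs => ?_) (by fun_prop)
      exact (Real.continuousAt_rpow_const s p (Or.inr (by linarith))).continuousWithinAt
    · intro s hs
      rw [interior_Icc] at hs
      have hs0 : s ≠ 0 := by have := hs.1; intro h; subst h; linarith
      have h1 := Real.hasDerivAt_rpow_const (x := s) (p := p) (Or.inl hs0)
      have h2 : HasDerivAt (fun s : ℝ => c * s ^ 2) (c * (2 * s)) s := by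
        simpa using (hasDerivAt_pow 2 s).const_mul c
      exact (h1.sub h2).hasDerivWithinAt
    · intro s hs
      rw [interior_Icc] at hs
      have hs0 : s ≠ 0 := by have := hs.1; intro h; subst h; linarith
      have h1 := (Real.hasDerivAt_rpow_const (x := s) (p := p - 1) (Or.inl hs0)).const_mul p
      have h2 : HasDerivAt (fun s : ℝ => c * (2 * s)) (c * 2) s := by
        simpa using ((hasDerivAt_id s).const_mul 2).const_mul c
      exact (h1.sub h2).hasDerivWithinAt
    · intro s hs
      rw [interior_Icc] at hs
      have hs0 : 0 < s := by linarith [hs.1]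
      have h1 : (1 / 2) ^ p * (4 / 9) ≤ s ^ (p - 1 - 1) := by
        rw [show p - 1 - 1 = p - (2 : ℕ) by push_cast; ring, Real.rpow_sub hs0,
          Real.rpow_natCast, le_div_iff₀ (by positivity)]
        have h2 : (1 / 2 : ℝ) ^ p ≤ s ^ p :=
          Real.rpow_le_rpow (by norm_num) hs.1.le (by linarith)
        have h3 : (4 / 9) * s ^ 2 ≤ 1 := by nlinarith [hs.1, hs.2]
        calc (1 / 2 : ℝ) ^ p * (4 / 9) * s ^ 2 = (1 / 2 : ℝ) ^ p * ((4 / 9) * s ^ 2) := by ring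
          _ ≤ s ^ p * 1 := by gcongr
          _ = s ^ p := mul_one _
      have h4 := mul_le_mul_of_nonneg_left h1 (by positivity : 0 ≤ p * (p - 1))
      have h5 : c * 2 = p * (p - 1) * ((1 / 2) ^ p * (4 / 9)) := by rw [hc]; ring
      simp only [h5]
      linarith
  refine ⟨2 * c, by positivity, fun x u hu => ?_⟩
  rcases eq_or_ne x 0 with rfl | hx
  · have : u = 0 := by simpa using hu
    simp [this, Real.zero_rpow (by linarith : p ≠ 0)]
  have hx' : 0 < |x| := abs_pos.mpr hx
  set s := u / x with hs
  have hus : u = x * s := by rw [hs]; field_simp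
  have hs1 : |s| ≤ 1 / 2 := by rw [hs, abs_div, div_le_iff₀ hx']; linarith
  obtain ⟨hs2, hs3⟩ := abs_le.mp hs1
  have h := hconv.2 (x := 1 + s) (y := 1 - s) ⟨by linarith, by linarith⟩
    ⟨by linarith, by linarith⟩ (by norm_num : (0 : ℝ) ≤ 1 / 2)
    (by norm_num : (0 : ℝ) ≤ 1 / 2) (by norm_num)
  simp only [smul_eq_mul] at h
  rw [show 1 / 2 * (1 + s) + 1 / 2 * (1 - s) = 1 by ring, Real.one_rpow] at h
  have h1 : 2 * c * s ^ 2 ≤ (1 + s) ^ p + (1 - s) ^ p - 2 := by linarith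
  have e1 : |x + u| ^ p = |x| ^ p * (1 + s) ^ p := by
    rw [hus, show x + x * s = x * (1 + s) by ring, abs_mul,
      Real.mul_rpow (abs_nonneg _) (abs_nonneg _), abs_of_nonneg (by linarith : 0 ≤ 1 + s)]
  have e2 : |x - u| ^ p = |x| ^ p * (1 - s) ^ p := by
    rw [hus, show x - x * s = x * (1 - s) by ring, abs_mul,
      Real.mul_rpow (abs_nonneg _) (abs_nonneg _), abs_of_nonneg (by linarith : 0 ≤ 1 - s)]
  rw [e1, e2]
  have := mul_le_mul_of_nonneg_left h1 (by positivity : 0 ≤ |x| ^ p)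
  linarith

lemma exists_one_add_rpow_le_one_add_mul (r : ℝ) :
    ∃ C : ℝ, ∀ u : ℝ, 0 ≤ u → u ≤ 1 → (1 + u) ^ r ≤ 1 + C * u := by
  refine ⟨2 ^ max r 1, fun u hu hu1 => ?_⟩
  have h := (convexOn_rpow (le_max_right r 1)).2 (x := 1) (y := 2) (by norm_num) (by norm_num)
    (by linarith : 0 ≤ 1 - u) hu (by ring)
  simp only [smul_eq_mul, Real.one_rpow] at h
  rw [show (1 - u) * 1 + u * 2 = 1 + u by ring] at h
  calc (1 + u) ^ r ≤ (1 + u) ^ max r 1 :=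
        Real.rpow_le_rpow_of_exponent_le (by linarith) (le_max_left _ _)
    _ ≤ _ := by linarith

/-- Near zero, a multiple of `t ^ α` bounds no positive multiple of `t ^ β` when `β < α`. -/
lemma nonpos_of_mul_rpow_le {α β A C δ : ℝ} (hαβ : β < α) (hδ : 0 < δ)
    (h : ∀ t : ℝ, 0 < t → t ≤ δ → A * t ^ β ≤ C * t ^ α) : A ≤ 0 := by
  have hlim : Filter.Tendsto (fun t : ℝ => C * t ^ (α - β)) (nhdsWithin 0 (Set.Ioi 0))
      (nhds 0) := by
    have h1 := (Real.continuousAt_rpow_const 0 (α - β) (Or.inr (by linarith))).tendsto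
    rw [Real.zero_rpow (by linarith)] at h1
    simpa using (h1.const_mul C).mono_left nhdsWithin_le_nhds
  refine ge_of_tendsto hlim ?_
  filter_upwards [Ioc_mem_nhdsGT hδ] with t ht
  have h1 := h t ht.1 ht.2
  have h2 : 0 < t ^ β := Real.rpow_pos_of_pos ht.1 _
  rw [Real.rpow_sub ht.1, ← mul_div_assoc, le_div_iff₀ h2]
  exact h1

lemma le_of_two_rpow_div_le_two {p q : ℝ} (hq : 0 < q) (h : (2 : ℝ) ^ (p / q) ≤ 2) : p ≤ q := by
  have h1 : (2 : ℝ) ^ (p / q) ≤ 2 ^ (1 : ℝ) := by rwa [Real.rpow_one]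
  rw [Real.rpow_le_rpow_left_iff (by norm_num), div_le_one hq] at h1
  exact h1

section

variable {Ω : Type*} [MeasurableSpace Ω] {μ : Measure Ω} {p q : ℝ} {f g : Ω → ℝ}

lemma le_of_integral_abs_rpow_of_le_two (hp : 1 < p) (hp2 : p ≤ 2) (hq : 0 < q)
    (hInt : ∀ a b : ℝ, Integrable (fun ω => |a * f ω + b * g ω| ^ p) μ)
    (hval : ∀ a b : ℝ, ∫ ω, |a * f ω + b * g ω| ^ p ∂μ = (|a| ^ q + |b| ^ q) ^ (p / q)) :
    p ≤ q := by
  have h := integral_mono ((hInt 1 1).add (hInt 1 (-1)))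
    (((hInt 1 0).add (hInt 0 1)).const_mul 2) (fun ω => by
      have := abs_add_rpow_add_abs_sub_rpow_le hp hp2 (f ω) (g ω)
      simpa [sub_eq_add_neg] using this)
  simp only [Pi.add_apply] at h
  rw [integral_add (hInt 1 1) (hInt 1 (-1)), integral_const_mul,
    integral_add (hInt 1 0) (hInt 0 1), hval, hval, hval, hval] at h
  simp only [abs_one, abs_zero, abs_neg, Real.one_rpow, Real.zero_rpow hq.ne', add_zero,
    zero_add] at h
  norm_num at h
  exact le_of_two_rpow_div_le_two hq (by linarith)

lemma integral_second_difference_abs_rpow (hq : 0 < q)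
    (hInt : ∀ a b : ℝ, Integrable (fun ω => |a * f ω + b * g ω| ^ p) μ)
    (hval : ∀ a b : ℝ, ∫ ω, |a * f ω + b * g ω| ^ p ∂μ = (|a| ^ q + |b| ^ q) ^ (p / q))
    {t : ℝ} (ht : 0 < t) :
    Integrable (fun ω => |f ω + t * g ω| ^ p + |f ω - t * g ω| ^ p - 2 * |f ω| ^ p) μ ∧
    ∫ ω, |f ω + t * g ω| ^ p + |f ω - t * g ω| ^ p - 2 * |f ω| ^ p ∂μ
      = 2 * (1 + t ^ q) ^ (p / q) - 2 := by
  have i1 : Integrable (fun ω => |f ω + t * g ω| ^ p) μ := by simpa using hInt 1 t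
  have i2 : Integrable (fun ω => |f ω - t * g ω| ^ p) μ := by
    simpa [← sub_eq_add_neg] using hInt 1 (-t)
  have i3 : Integrable (fun ω => |f ω| ^ p) μ := by simpa using hInt 1 0
  have v1 := hval 1 t
  have v2 := hval 1 (-t)
  have v3 := hval 1 0
  simp only [abs_one, abs_zero, abs_neg, Real.one_rpow, Real.zero_rpow hq.ne', add_zero,
    abs_of_pos ht, one_mul, zero_mul, neg_mul, ← sub_eq_add_neg] at v1 v2 v3
  have i12 : Integrable (fun ω => |f ω + t * g ω| ^ p + |f ω - t * g ω| ^ p) μ := i1.add i2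
  refine ⟨i12.sub (i3.const_mul 2), ?_⟩
  rw [integral_sub i12 (i3.const_mul 2), integral_add i1 i2, integral_const_mul, v1, v2, v3]
  ring

lemma false_of_integral_abs_rpow_of_lt_two (hp : 2 < p) (hq : 0 < q) (hq2 : q < 2)
    (hInt : ∀ a b : ℝ, Integrable (fun ω => |a * f ω + b * g ω| ^ p) μ)
    (hval : ∀ a b : ℝ, ∫ ω, |a * f ω + b * g ω| ^ p ∂μ = (|a| ^ q + |b| ^ q) ^ (p / q)) :
    False := by
  obtain ⟨C, hC⟩ := exists_second_difference_abs_rpow_le hp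
  have hr : 1 ≤ p / q := by rw [le_div_iff₀ hq]; linarith
  have key : ∀ t : ℝ, 0 < t → t ≤ 1 → 1 * t ^ q ≤ C * t ^ (2 : ℝ) := by
    intro t ht ht1
    obtain ⟨hi, hv⟩ := integral_second_difference_abs_rpow hq hInt hval ht
    have h := integral_mono hi
      (((hInt 1 0).add (hInt 0 1)).const_mul (C * t ^ 2)) (fun ω => by
        simpa using hC (f ω) (g ω) t ht.le ht1)
    simp only [Pi.add_apply] at h
    rw [hv, integral_const_mul, integral_add (hInt 1 0) (hInt 0 1), hval, hval] at h
    simp only [abs_one, abs_zero, Real.one_rpow, Real.zero_rpow hq.ne', add_zero, zero_add] at h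
    have htq : 0 ≤ t ^ q := by positivity
    have h1 := one_add_mul_self_le_rpow_one_add (by linarith : -1 ≤ t ^ q) hr
    have h2 : t ^ q ≤ p / q * t ^ q := le_mul_of_one_le_left htq hr
    rw [Real.rpow_two]
    linarith
  have := nonpos_of_mul_rpow_le hq2 one_pos key
  linarith

lemma ae_eq_zero_or_eq_zero_of_integral_abs_rpow (hp : 1 < p) (hq : 2 < q)
    (hf : AEStronglyMeasurable f μ) (hg : AEStronglyMeasurable g μ)
    (hInt : ∀ a b : ℝ, Integrable (fun ω => |a * f ω + b * g ω| ^ p) μ)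
    (hval : ∀ a b : ℝ, ∫ ω, |a * f ω + b * g ω| ^ p ∂μ = (|a| ^ q + |b| ^ q) ^ (p / q)) :
    ∀ᵐ ω ∂μ, f ω = 0 ∨ g ω = 0 := by
  obtain ⟨c, hc, hcle⟩ := exists_le_second_difference_abs_rpow hp
  obtain ⟨C, hC⟩ := exists_one_add_rpow_le_one_add_mul (p / q)
  have hq0 : 0 < q := by linarith
  have hintf : Integrable (fun ω => |f ω| ^ p) μ := by simpa using hInt 1 0
  have key : ∀ N : ℕ, ∀ᵐ ω ∂μ, |g ω| ≤ (N + 1) * |f ω| / 2 → f ω = 0 ∨ g ω = 0 := by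
    intro N
    set E : Set (ℝ × ℝ) := {z | |z.2| ≤ (N + 1) * |z.1| / 2} with hE
    have hEm : MeasurableSet E := measurableSet_le (by fun_prop) (by fun_prop)
    set W : ℝ × ℝ → ℝ := E.indicator (fun z => |z.1| ^ p * (z.2 / z.1) ^ 2) with hW
    have hWm : Measurable W := Measurable.indicator (by fun_prop) hEm
    have hW0 : ∀ z, 0 ≤ W z := fun z => Set.indicator_nonneg (fun z _ => by positivity) z
    have hWint : Integrable (fun ω => W (f ω, g ω)) μ := by
      refine (hintf.const_mul (((N : ℝ) + 1) ^ 2)).mono'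
        (hWm.comp_aemeasurable (hf.aemeasurable.prodMk hg.aemeasurable)).aestronglyMeasurable
        (Filter.Eventually.of_forall fun ω => ?_)
      rw [Real.norm_of_nonneg (hW0 _), hW, Set.indicator_apply]
      split_ifs with hω
      · have h1 : |g ω / f ω| ≤ N + 1 := by
          rw [abs_div]
          refine div_le_of_le_mul₀ (abs_nonneg _) (by positivity) ?_
          have h2 : |g ω| ≤ (N + 1) * |f ω| / 2 := hω
          have h3 : 0 ≤ ((N : ℝ) + 1) * |f ω| := by positivity
          linarith
        have h2 : (g ω / f ω) ^ 2 ≤ ((N : ℝ) + 1) ^ 2 := by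
          rw [← sq_abs]; exact pow_le_pow_left₀ (abs_nonneg _) h1 2
        rw [mul_comm]
        exact mul_le_mul_of_nonneg_right h2 (by positivity)
      · positivity
    have hzero : c * ∫ ω, W (f ω, g ω) ∂μ ≤ 0 := by
      refine nonpos_of_mul_rpow_le (α := q) (β := 2) (C := 2 * C) (δ := 1 / (N + 1)) hq
        (by positivity) fun t ht htN => ?_
      have ht1 : t ≤ 1 := htN.trans (by
        rw [div_le_one (by positivity)]; linarith [(Nat.cast_nonneg N : (0 : ℝ) ≤ N)])
      obtain ⟨hi, hv⟩ := integral_second_difference_abs_rpow hq0 hInt hval ht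
      have h := integral_mono (hWint.const_mul (c * t ^ 2)) hi (fun ω => by
          have h1 := two_mul_abs_rpow_le hp (f ω) (t * g ω)
          change c * t ^ 2 * W (f ω, g ω) ≤ _
          rw [hW, Set.indicator_apply]
          split_ifs with hω
          · have h3 : |g ω| ≤ (N + 1) * |f ω| / 2 := hω
            have h4 : |t * g ω| ≤ |f ω| / 2 := by
              rw [abs_mul, abs_of_pos ht]
              rw [le_div_iff₀ (by positivity)] at htN
              calc t * |g ω| ≤ t * ((N + 1) * |f ω| / 2) := by gcongr
                _ = t * (N + 1) * (|f ω| / 2) := by ring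
                _ ≤ 1 * (|f ω| / 2) := by gcongr
                _ = |f ω| / 2 := one_mul _
            have h5 := hcle (f ω) (t * g ω) h4
            rw [mul_div_assoc, mul_pow] at h5
            linarith
          · linarith)
      rw [hv, integral_const_mul] at h
      have h6 := hC (t ^ q) (by positivity) (Real.rpow_le_one ht.le ht1 hq0.le)
      rw [Real.rpow_two]
      linarith
    have hI : ∫ ω, W (f ω, g ω) ∂μ = 0 :=
      le_antisymm (nonpos_of_mul_nonpos_right hzero hc) (integral_nonneg fun ω => hW0 _)
    rw [integral_eq_zero_iff_of_nonneg (fun ω => hW0 _) hWint] at hI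
    filter_upwards [hI] with ω hω hle
    have hmem : (f ω, g ω) ∈ E := hle
    rw [hW, Set.indicator_of_mem hmem] at hω
    by_contra! hne
    have h1 : 0 < |f ω| := abs_pos.mpr hne.1
    have h2 : g ω / f ω ≠ 0 := div_ne_zero hne.2 hne.1
    have h3 : 0 < |f ω| ^ p * (g ω / f ω) ^ 2 := by positivity
    exact h3.ne' hω
  filter_upwards [ae_all_iff.mpr key] with ω hω
  by_cases h0 : f ω = 0
  · exact Or.inl h0
  have h1 : 0 < |f ω| := abs_pos.mpr h0
  obtain ⟨N, hN⟩ := exists_nat_ge (2 * |g ω| / |f ω|)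
  refine hω N ?_
  rw [div_le_iff₀ h1] at hN
  linarith

lemma eq_of_integral_abs_rpow_of_two_lt (hp : 1 < p) (hq : 2 < q)
    (hf : AEStronglyMeasurable f μ) (hg : AEStronglyMeasurable g μ)
    (hInt : ∀ a b : ℝ, Integrable (fun ω => |a * f ω + b * g ω| ^ p) μ)
    (hval : ∀ a b : ℝ, ∫ ω, |a * f ω + b * g ω| ^ p ∂μ = (|a| ^ q + |b| ^ q) ^ (p / q)) :
    q = p := by
  have hq0 : 0 < q := by linarith
  have hp0 : p ≠ 0 := by linarith
  have h : ∫ ω, |1 * f ω + 1 * g ω| ^ p ∂μ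
      = ∫ ω, |1 * f ω + 0 * g ω| ^ p + |0 * f ω + 1 * g ω| ^ p ∂μ := by
    refine integral_congr_ae ?_
    filter_upwards [ae_eq_zero_or_eq_zero_of_integral_abs_rpow hp hq hf hg hInt hval] with ω hω
    rcases hω with h0 | h0 <;> simp [h0, Real.zero_rpow hp0]
  rw [integral_add (hInt 1 0) (hInt 0 1), hval, hval, hval] at h
  simp only [abs_one, abs_zero, Real.one_rpow, Real.zero_rpow hq0.ne', add_zero, zero_add] at h
  norm_num at h
  have h1 : (2 : ℝ) ^ (p / q) = 2 ^ (1 : ℝ) := by rwa [Real.rpow_one]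
  have h2 := (Real.rpow_right_inj (by norm_num) (by norm_num)).mp h1
  rw [div_eq_one_iff_eq hq0.ne'] at h2
  exact h2.symm

lemma Lp_integrable_abs_rpow (hp : 0 < p) (F : Lp ℝ (ENNReal.ofReal p) μ) :
    Integrable (fun ω => |F ω| ^ p) μ := by
  have h := (Lp.memLp F).integrable_norm_rpow (by simpa using hp) ENNReal.ofReal_ne_top
  simpa [ENNReal.toReal_ofReal hp.le] using h

lemma Lp_integral_abs_rpow (hp : 0 < p) (F : Lp ℝ (ENNReal.ofReal p) μ) :
    ∫ ω, |F ω| ^ p ∂μ = ‖F‖ ^ p := by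
  have h0 : 0 ≤ ∫ ω, |F ω| ^ p ∂μ := integral_nonneg fun ω => by positivity
  rw [Lp.norm_def, (Lp.memLp F).eLpNorm_eq_integral_rpow_norm (by simpa using hp)
    ENNReal.ofReal_ne_top, ENNReal.toReal_ofReal hp.le]
  simp only [Real.norm_eq_abs]
  rw [ENNReal.toReal_ofReal (by positivity), Real.rpow_inv_rpow h0 hp.ne']

end

/-- For a positive measure `μ` on `[0,1]`, `p ∈ (1,∞)`, and `q ∈ [1,∞)` with either
`1 ≤ q < 2` and `q < p`, or `2 < q` and `q ≠ p`, the space `ℓ_q²(ℝ)` does not embed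
isometrically into `L_p([0,1], ℝ, dμ)`: there is no linear map `T` from `ℝ²` to `L_p(μ)`
with `‖T a‖_{L_p(μ)} = (|a₁|^q + |a₂|^q)^{1/q}` for all `a ∈ ℝ²`. -/
theorem no_isometric_embedding_lq2_into_Lp
    (μ : Measure (Set.Icc (0 : ℝ) 1)) (p q : ℝ) (hp : 1 < p) (hq : 1 ≤ q)
    (h : (1 ≤ q ∧ q < 2 ∧ q < p) ∨ (2 < q ∧ q ≠ p)) :
    ¬ ∃ T : (Fin 2 → ℝ) →ₗ[ℝ] Lp ℝ (ENNReal.ofReal p) μ,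
      ∀ a : Fin 2 → ℝ, ‖T a‖ = (|a 0| ^ q + |a 1| ^ q) ^ (1 / q) := by
  rintro ⟨T, hT⟩
  have hp0 : 0 < p := by linarith
  have hq0 : 0 < q := by linarith
  set f := T ![1, 0]
  set g := T ![0, 1]
  have hlin : ∀ a b : ℝ, T ![a, b] = a • f + b • g := by
    intro a b
    rw [← map_smul, ← map_smul, ← map_add]
    congr 1
    ext i
    fin_cases i <;> simp
  have hae : ∀ a b : ℝ, (fun ω => |T ![a, b] ω| ^ p) =ᵐ[μ] fun ω => |a * f ω + b * g ω| ^ p := by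
    intro a b
    rw [hlin]
    filter_upwards [Lp.coeFn_add (a • f) (b • g), Lp.coeFn_smul a f, Lp.coeFn_smul b g]
      with ω h1 h2 h3
    rw [h1, Pi.add_apply, h2, h3]
    rfl
  have hInt : ∀ a b : ℝ, Integrable (fun ω => |a * f ω + b * g ω| ^ p) μ := fun a b =>
    (Lp_integrable_abs_rpow hp0 (T ![a, b])).congr (hae a b)
  have hval : ∀ a b : ℝ,
      ∫ ω, |a * f ω + b * g ω| ^ p ∂μ = (|a| ^ q + |b| ^ q) ^ (p / q) := by
    intro a b
    rw [← integral_congr_ae (hae a b), Lp_integral_abs_rpow hp0, hT,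
      ← Real.rpow_mul (by positivity)]
    simp [div_eq_inv_mul]
  rcases h with ⟨-, hq2, hqp⟩ | ⟨hq2, hqp⟩
  · rcases le_or_gt p 2 with hp2 | hp2
    · exact absurd (le_of_integral_abs_rpow_of_le_two hp hp2 hq0 hInt hval) (not_le.mpr hqp)
    · exact false_of_integral_abs_rpow_of_lt_two hp2 hq0 hq2 hInt hval
  · exact hqp (eq_of_integral_abs_rpow_of_two_lt hp hq2 (Lp.aestronglyMeasurable f)
      (Lp.aestronglyMeasurable g) hInt hval)
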